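/- Consider a non-stationary K-armed bandit satisfying Assumption A2 with constants θ, ξ, η, run with the UCB-ERM algorithm with parameter α > 2. Then for every sub-optimal arm i (Δ_i > 0) and every n ∈ ℕ: E[T_i(n)] ≤ (2 θ^{1/ξ} / Δ_i)^{1/(1−η)} n^{α/(ξ(1−η))} + 2/(α − 2) + 1. -/

import Mathlib

open MeasureTheory ProbabilityTheory Filter

/-- The empirical ERM_β estimator `ρ̂_n = (1/β) ln((1/n) Σ_{t<n} exp(β x_t))` (the sum runs
over the first `n` samples). -/
noncomputable def ermEst (β : ℝ) (n : ℕ) (x : ℕ → ℝ) : ℝ :=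
  (1 / β) * Real.log ((1 / (n : ℝ)) * ∑ t ∈ Finset.range n, Real.exp (β * x t))

/-- The UCB exploration bonus `b_{t,s} = θ^{1/ξ} t^{α/ξ} / s^{1−η}`. -/
noncomputable def bonus (θ ξ η α : ℝ) (t s : ℕ) : ℝ :=
  θ ^ (1 / ξ) * (t : ℝ) ^ (α / ξ) / (s : ℝ) ^ (1 - η)

/-- `pulls a i t ω` : the number of pulls `T_i(t)` of arm `i` up to and including round `t`
(rounds are indexed `1, 2, …`). -/
def pulls {Ω : Type*} {K : ℕ} (a : ℕ → Ω → Fin K) (i : Fin K) (t : ℕ) (ω : Ω) : ℕ :=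
  ((Finset.Icc 1 t).filter fun s => a s ω = i).card

theorem pulls_succ {Ω : Type*} {K : ℕ} (a : ℕ → Ω → Fin K) (i : Fin K) (t : ℕ) (ω : Ω) :
    pulls a i (t + 1) ω = pulls a i t ω + if a (t + 1) ω = i then 1 else 0 := by
  unfold pulls
  rw [← Finset.insert_Icc_right_eq_Icc_add_one (by omega), Finset.filter_insert]
  split_ifs
  · rw [Finset.card_insert_of_notMem (by simp)]
  · simp

theorem pulls_le {Ω : Type*} {K : ℕ} (a : ℕ → Ω → Fin K) (i : Fin K) (t : ℕ) (ω : Ω) :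
    pulls a i t ω ≤ t := by
  simpa [pulls] using Finset.card_filter_le (Finset.Icc 1 t) (fun s => a s ω = i)

theorem pulls_pos_iff {Ω : Type*} {K : ℕ} (a : ℕ → Ω → Fin K) (i : Fin K) (t : ℕ) (ω : Ω) :
    1 ≤ pulls a i t ω ↔ ∃ s, 1 ≤ s ∧ s ≤ t ∧ a s ω = i := by
  simp [pulls, Nat.one_le_iff_ne_zero, ← Nat.pos_iff_ne_zero]

/-- At most `u` pulls of an arm occur before it has been pulled `u` times. -/
theorem pulls_le_add_card {Ω : Type*} {K : ℕ} (a : ℕ → Ω → Fin K) (i : Fin K) (u n : ℕ) (ω : Ω) :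
    pulls a i n ω ≤
      u + ((Finset.Icc 1 n).filter fun t => a t ω = i ∧ u ≤ pulls a i (t - 1) ω).card := by
  induction n with
  | zero => simp [pulls]
  | succ n ih =>
    rw [pulls_succ, ← Finset.insert_Icc_right_eq_Icc_add_one (by omega), Finset.filter_insert]
    simp only [Nat.add_sub_cancel]
    by_cases h : a (n + 1) ω = i
    · by_cases h' : u ≤ pulls a i n ω
      · rw [if_pos h, if_pos ⟨h, h'⟩, Finset.card_insert_of_notMem (by simp)]
        omega
      · rw [if_pos h, if_neg (by tauto)]
        omega
    · rw [if_neg h, if_neg (by tauto)]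
      omega

theorem sum_Icc_two_rpow_le {α : ℝ} (hα : 2 < α) (n : ℕ) :
    ∑ t ∈ Finset.Icc 2 n, (t : ℝ) ^ (1 - α) ≤ 1 / (α - 2) := by
  have key : ∀ m : ℕ, ∑ t ∈ Finset.Icc 2 (m + 1), (t : ℝ) ^ (1 - α)
      = ∑ i ∈ Finset.range m, (1 + ((i + 1 : ℕ) : ℝ)) ^ (1 - α) := by
    intro m
    induction m with
    | zero => simp
    | succ m ih =>
      rw [Finset.sum_range_succ, ← ih, Finset.sum_Icc_succ_top (by omega)]
      push_cast
      ring_nf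
  have hanti : AntitoneOn (fun y : ℝ => y ^ (1 - α)) (Set.Icc (1 : ℝ) (1 + (n : ℝ))) := by
    intro p hp q _ hpq
    exact Real.rpow_le_rpow_of_nonpos (by linarith [hp.1]) hpq (by linarith)
  have h1 := hanti.sum_le_integral
  rw [integral_rpow (Or.inr ⟨by linarith, by
    rw [Set.uIcc_of_le (by linarith [Nat.cast_nonneg (α := ℝ) n])]
    intro h
    linarith [h.1]⟩)] at h1
  calc ∑ t ∈ Finset.Icc 2 n, (t : ℝ) ^ (1 - α)
      ≤ ∑ t ∈ Finset.Icc 2 (n + 1), (t : ℝ) ^ (1 - α) :=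
        Finset.sum_le_sum_of_subset_of_nonneg (Finset.Icc_subset_Icc le_rfl (by omega))
          fun _ _ _ => by positivity
    _ ≤ _ := (key n).le.trans h1
    _ = (1 - (1 + (n : ℝ)) ^ (2 - α)) / (α - 2) := by
        rw [Real.one_rpow, show 1 - α + 1 = 2 - α by ring, ← neg_div_neg_eq]
        congr 1 <;> ring
    _ ≤ 1 / (α - 2) := by
        have : (0 : ℝ) ≤ (1 + (n : ℝ)) ^ (2 - α) := by positivity
        exact div_le_div_of_nonneg_right (by linarith) (by linarith)

theorem measurable_ermEst {Ω : Type*} [MeasurableSpace Ω] (β : ℝ) (n : ℕ) {x : ℕ → Ω → ℝ}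
    (hx : ∀ t, Measurable (x t)) : Measurable fun ω => ermEst β n fun t => x t ω := by
  unfold ermEst
  fun_prop

/-- The scaled bonus is the deviation threshold at level `z = θ^{1/ξ} t^{α/ξ}`. -/
theorem mul_bonus (θ ξ η α : ℝ) (t : ℕ) {s : ℕ} (hs : 1 ≤ s) :
    (s : ℝ) * bonus θ ξ η α t s = (s : ℝ) ^ η * (θ ^ (1 / ξ) * (t : ℝ) ^ (α / ξ)) := by
  have hs' : (0 : ℝ) < s := by exact_mod_cast hs
  unfold bonus
  rw [Real.rpow_sub hs', Real.rpow_one]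
  have := (Real.rpow_pos_of_pos hs' η).ne'
  field_simp

theorem div_threshold_rpow {θ ξ : ℝ} (hθ : 1 < θ) (hξ : 1 < ξ) (α : ℝ) {t : ℕ} (ht : 1 ≤ t) :
    θ / (θ ^ (1 / ξ) * (t : ℝ) ^ (α / ξ)) ^ ξ = (t : ℝ) ^ (-α) := by
  have ht' : (0 : ℝ) < t := by exact_mod_cast ht
  have hξ0 : ξ ≠ 0 := by linarith
  rw [Real.mul_rpow (by positivity) (by positivity), ← Real.rpow_mul (by linarith),
    ← Real.rpow_mul ht'.le, div_mul_cancel₀ _ hξ0, div_mul_cancel₀ _ hξ0, Real.rpow_one,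
    Real.rpow_neg ht'.le]
  have : θ ≠ 0 := by linarith
  field_simp

theorem one_le_threshold {θ ξ α : ℝ} (hθ : 1 < θ) (hξ : 1 < ξ) (hα : 2 < α) {t : ℕ}
    (ht : 1 ≤ t) : 1 ≤ θ ^ (1 / ξ) * (t : ℝ) ^ (α / ξ) := by
  have ht' : (1 : ℝ) ≤ t := by exact_mod_cast ht
  exact one_le_mul_of_one_le_of_one_le (Real.one_le_rpow hθ.le (by positivity))
    (Real.one_le_rpow ht' (div_nonneg (by linarith) (by linarith)))

/-- Once an arm with gap `Δ` has been pulled often enough, its bonus is at most `Δ / 2`. -/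
theorem two_mul_bonus_le {θ ξ η α Δ : ℝ} (hθ : 1 < θ) (hξ : 1 < ξ) (hη1 : η < 1) (hα : 2 < α)
    (hΔ : 0 < Δ) {t n s : ℕ} (htn : t ≤ n) (hs1 : 1 ≤ s)
    (hs : (2 * θ ^ (1 / ξ) / Δ) ^ (1 / (1 - η)) * (n : ℝ) ^ (α / (ξ * (1 - η))) ≤ s) :
    2 * bonus θ ξ η α t s ≤ Δ := by
  have hη0 : 0 < 1 - η := by linarith
  have hξ0 : 0 < ξ := by linarith
  have hs0 : (0 : ℝ) < s := by exact_mod_cast hs1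
  have hθ0 : 0 < θ ^ (1 / ξ) := by positivity
  have h := Real.rpow_le_rpow (by positivity) hs hη0.le
  rw [Real.mul_rpow (by positivity) (by positivity), ← Real.rpow_mul (by positivity),
    ← Real.rpow_mul (by positivity), one_div_mul_cancel hη0.ne', Real.rpow_one,
    show α / (ξ * (1 - η)) * (1 - η) = α / ξ by field_simp] at h
  have ht : (t : ℝ) ^ (α / ξ) ≤ (n : ℝ) ^ (α / ξ) :=
    Real.rpow_le_rpow (by positivity) (by exact_mod_cast htn)
      (div_nonneg (by linarith) hξ0.le)
  have hp : 0 < (s : ℝ) ^ (1 - η) := by positivity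
  unfold bonus
  rw [← mul_div_assoc, div_le_iff₀ hp]
  rw [div_mul_eq_mul_div, div_le_iff₀ hΔ] at h
  nlinarith [mul_le_mul_of_nonneg_left ht hθ0.le]

/-- Lemma 2: on a non-stationary `K`-armed bandit satisfying Assumption A2,
run with the UCB-ERM algorithm with `α > 2`, the expected number of pulls of any
sub-optimal arm `i` satisfies
`E[T_i(n)] ≤ (2θ^{1/ξ}/Δ_i)^{1/(1−η)} n^{α/(ξ(1−η))} + 2/(α−2) + 1` for every `n`. -/
theorem stmt8 {Ω : Type*} [MeasurableSpace Ω] (P : Measure Ω) [IsProbabilityMeasure P]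
    (K : ℕ) (hK : 1 ≤ K) (R β : ℝ) (hR : 0 < R) (hβ : 0 < β)
    (x : Fin K → ℕ → Ω → ℝ) (hxmeas : ∀ i t, Measurable (x i t))
    (hxbdd : ∀ i t ω, x i t ω ∈ Set.Icc (-R) R)
    (θ ξ η α : ℝ) (hθ : 1 < θ) (hξ : 1 < ξ) (hη : 1 / 2 ≤ η) (hη1 : η < 1) (hα2 : 2 < α)
    (μ : Fin K → ℝ)
    (hconv : ∀ i, Tendsto (fun n => ∫ ω, ermEst β n (fun t => x i t ω) ∂P) atTop
      (nhds (μ i)))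
    (hconcU : ∀ i, ∀ n : ℕ, 1 ≤ n → ∀ z : ℝ, 1 ≤ z →
      P {ω | (n : ℝ) ^ η * z ≤ (n : ℝ) * ermEst β n (fun t => x i t ω) - (n : ℝ) * μ i}
        ≤ ENNReal.ofReal (θ / z ^ ξ))
    (hconcL : ∀ i, ∀ n : ℕ, 1 ≤ n → ∀ z : ℝ, 1 ≤ z →
      P {ω | (n : ℝ) * ermEst β n (fun t => x i t ω) - (n : ℝ) * μ i ≤ -((n : ℝ) ^ η * z)}
        ≤ ENNReal.ofReal (θ / z ^ ξ))
    (istar : Fin K) (hstar : ∀ j, j ≠ istar → μ istar < μ j)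
    (a : ℕ → Ω → Fin K) (hameas : ∀ t, Measurable (a t))
    (hinit : ∀ ω, ∀ t, 1 ≤ t → t ≤ K → ((a t ω : ℕ) = t - 1))
    (hsel : ∀ ω, ∀ t, K < t → ∀ i : Fin K,
      ermEst β (pulls a (a t ω) (t - 1) ω) (fun u => x (a t ω) u ω)
          - bonus θ ξ η α t (pulls a (a t ω) (t - 1) ω)
        ≤ ermEst β (pulls a i (t - 1) ω) (fun u => x i u ω)
          - bonus θ ξ η α t (pulls a i (t - 1) ω)) :
    ∀ i : Fin K, 0 < μ i - μ istar →
      ∀ n : ℕ,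
        ∫ ω, (pulls a i n ω : ℝ) ∂P
          ≤ (2 * θ ^ (1 / ξ) / (μ i - μ istar)) ^ (1 / (1 - η))
              * (n : ℝ) ^ (α / (ξ * (1 - η))) + 2 / (α - 2) + 1 := by
  intro i hi n
  rcases Nat.eq_zero_or_pos n with rfl | hn
  · have h2 : 0 < 2 / (α - 2) := div_pos two_pos (by linarith)
    have : 0 ≤ (2 * θ ^ (1 / ξ) / (μ i - μ istar)) ^ (1 / (1 - η))
        * ((0 : ℕ) : ℝ) ^ (α / (ξ * (1 - η))) := by positivity
    simp only [pulls, Finset.Icc_eq_empty_of_lt one_pos, Finset.filter_empty, Finset.card_empty,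
      Nat.cast_zero, integral_zero] at this ⊢
    linarith
  set X : ℝ := (2 * θ ^ (1 / ξ) / (μ i - μ istar)) ^ (1 / (1 - η))
    * (n : ℝ) ^ (α / (ξ * (1 - η)))
  have hn' : (0 : ℝ) < n := by exact_mod_cast hn
  have hX0 : 0 < X := by positivity
  set u : ℕ := ⌈X⌉₊
  have hu1 : 1 ≤ u := Nat.ceil_pos.mpr hX0
  have huX : (u : ℝ) ≤ X + 1 := (Nat.ceil_lt_add_one hX0.le).le
  let A : ℕ → ℕ → Set Ω := fun t s => {ω | (s : ℝ) * bonus θ ξ η α t s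
    ≤ (s : ℝ) * ermEst β s (fun t => x istar t ω) - (s : ℝ) * μ istar}
  let B : ℕ → ℕ → Set Ω := fun t s =>
    {ω | (s : ℝ) * ermEst β s (fun t => x i t ω) - (s : ℝ) * μ i
      ≤ -((s : ℝ) * bonus θ ξ η α t s)}
  let bad : ℕ → Set Ω := fun t => ⋃ s ∈ Finset.Icc 1 (t - 1), (A t s ∪ B t s)
  have hbadmeas : ∀ t, MeasurableSet (bad t) := fun t =>
    Finset.measurableSet_biUnion _ fun s _ =>
      (measurableSet_le measurable_const
        (((measurable_ermEst β s (hxmeas istar)).const_mul _).sub_const _)).union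
      (measurableSet_le (((measurable_ermEst β s (hxmeas i)).const_mul _).sub_const _)
        measurable_const)
  have hprob : ∀ t ∈ Finset.Icc 2 n, P.real (bad t) ≤ 2 * (t : ℝ) ^ (1 - α) := by
    intro t ht
    have ht1 : 1 ≤ t := by have := (Finset.mem_Icc.mp ht).1; omega
    have ht0 : (0 : ℝ) < t := by exact_mod_cast ht1
    have hz := one_le_threshold hθ hξ hα2 ht1
    have hAB : ∀ s ∈ Finset.Icc 1 (t - 1), P.real (A t s ∪ B t s) ≤ 2 * (t : ℝ) ^ (-α) := by
      intro s hs
      have hs1 := (Finset.mem_Icc.mp hs).1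
      have hA : P.real (A t s) ≤ (t : ℝ) ^ (-α) := by
        refine ENNReal.toReal_le_of_le_ofReal (by positivity) ?_
        rw [← div_threshold_rpow hθ hξ α ht1]
        simpa only [A, mul_bonus θ ξ η α t hs1] using hconcU istar s hs1 _ hz
      have hB : P.real (B t s) ≤ (t : ℝ) ^ (-α) := by
        refine ENNReal.toReal_le_of_le_ofReal (by positivity) ?_
        rw [← div_threshold_rpow hθ hξ α ht1]
        simpa only [B, mul_bonus θ ξ η α t hs1] using hconcL i s hs1 _ hz
      linarith [measureReal_union_le (μ := P) (A t s) (B t s)]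
    calc P.real (bad t) ≤ ∑ s ∈ Finset.Icc 1 (t - 1), P.real (A t s ∪ B t s) :=
          measureReal_biUnion_finset_le _ _
      _ ≤ ∑ s ∈ Finset.Icc 1 (t - 1), 2 * (t : ℝ) ^ (-α) := Finset.sum_le_sum hAB
      _ ≤ t * (2 * (t : ℝ) ^ (-α)) := by
          rw [Finset.sum_const, nsmul_eq_mul, Nat.card_Icc]
          refine mul_le_mul_of_nonneg_right ?_ (by positivity)
          exact_mod_cast (by omega : t - 1 + 1 - 1 ≤ t)
      _ = 2 * (t : ℝ) ^ (1 - α) := by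
          rw [sub_eq_add_neg, Real.rpow_add ht0, Real.rpow_one]
          ring
  have hmem : ∀ ω t, 1 ≤ t → t ≤ n → a t ω = i → u ≤ pulls a i (t - 1) ω →
      2 ≤ t ∧ ω ∈ bad t := by
    intro ω t ht1 htn hat hut
    have hle := pulls_le a i (t - 1) ω
    have hKt : K < t := by
      by_contra hcon
      obtain ⟨s, hs1, hst, has⟩ := (pulls_pos_iff a i (t - 1) ω).mp (hu1.trans hut)
      have h1 := hinit ω t ht1 (by omega)
      have h2 := hinit ω s hs1 (by omega)
      rw [hat] at h1
      rw [has] at h2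
      omega
    refine ⟨by omega, ?_⟩
    have hi1 := hu1.trans hut
    have hstar1 : 1 ≤ pulls a istar (t - 1) ω := by
      refine (pulls_pos_iff a istar (t - 1) ω).mpr
        ⟨istar + 1, by omega, by have := istar.isLt; omega, ?_⟩
      apply Fin.ext
      rw [hinit ω (istar + 1) (by omega) istar.isLt]
      simp
    have hsel' := hsel ω t hKt istar
    rw [hat] at hsel'
    have hb := two_mul_bonus_le hθ hξ hη1 hα2 hi htn hi1
      ((Nat.le_ceil X).trans (by exact_mod_cast hut))
    have hle' := pulls_le a istar (t - 1) ω
    by_contra hcon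
    simp only [bad, Set.mem_iUnion, not_exists, Set.mem_union, not_or, Finset.mem_Icc] at hcon
    have hA := (hcon _ ⟨hstar1, hle'⟩).1
    have hB := (hcon _ ⟨hi1, hle⟩).2
    simp only [A, B, Set.mem_ofPred_eq, not_le, ← mul_sub, ← mul_neg] at hA hB
    have hA' := lt_of_mul_lt_mul_left hA (Nat.cast_nonneg _)
    have hB' := lt_of_mul_lt_mul_left hB (Nat.cast_nonneg _)
    linarith
  have hpath : ∀ ω, (pulls a i n ω : ℝ)
      ≤ u + ∑ t ∈ Finset.Icc 2 n, (bad t).indicator (fun _ => (1 : ℝ)) ω := by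
    classical
    intro ω
    have h1 : pulls a i n ω ≤ u + ((Finset.Icc 2 n).filter fun t => ω ∈ bad t).card := by
      refine (pulls_le_add_card a i u n ω).trans (Nat.add_le_add_left (Finset.card_le_card ?_) u)
      intro t ht
      simp only [Finset.mem_filter, Finset.mem_Icc] at ht ⊢
      obtain ⟨h2, hb⟩ := hmem ω t ht.1.1 ht.1.2 ht.2.1 ht.2.2
      exact ⟨⟨h2, ht.1.2⟩, hb⟩
    have h2 : ∑ t ∈ Finset.Icc 2 n, (bad t).indicator (fun _ => (1 : ℝ)) ω
        = (((Finset.Icc 2 n).filter fun t => ω ∈ bad t).card : ℝ) := by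
      simp [Set.indicator_apply]
    rw [h2]
    exact_mod_cast h1
  have hint : ∀ t ∈ Finset.Icc 2 n, Integrable ((bad t).indicator fun _ => (1 : ℝ)) P :=
    fun t _ => (integrable_const 1).indicator (hbadmeas t)
  calc ∫ ω, (pulls a i n ω : ℝ) ∂P
      ≤ ∫ ω, (u + ∑ t ∈ Finset.Icc 2 n, (bad t).indicator (fun _ => (1 : ℝ)) ω) ∂P :=
        integral_mono_of_nonneg (Eventually.of_forall fun _ => Nat.cast_nonneg _)
          ((integrable_const _).add (integrable_finsetSum _ hint)) (Eventually.of_forall hpath)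
    _ = u + ∑ t ∈ Finset.Icc 2 n, P.real (bad t) := by
        rw [integral_add (integrable_const _) (integrable_finsetSum _ hint),
          integral_finsetSum _ hint]
        simp [integral_indicator_const, hbadmeas]
    _ ≤ u + ∑ t ∈ Finset.Icc 2 n, 2 * (t : ℝ) ^ (1 - α) := by
        gcongr with t ht
        exact hprob t ht
    _ ≤ X + 2 / (α - 2) + 1 := by
        rw [← Finset.mul_sum]
        have h := sum_Icc_two_rpow_le hα2 n
        have : 2 / (α - 2) = 2 * (1 / (α - 2)) := by ring
        linarith
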